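/- Let f: [0,∞) → ℂ be defined by the power series f(x) = Σ_{n=0}^∞ (x^n / n!) · (binom(n+γ, n))^{-1} for γ > 0 (where binom(n+γ,n) = Γ(n+γ+1)/(Γ(γ+1)·n!)). Then for all x > 0, f(x) = e^x · x^{-γ} · ∫_0^x e^{-t} d(t^γ), i.e., f(x) = e^x · x^{-γ} · γ · ∫_0^x e^{-t} t^{γ-1} dt. In particular the power series defines an entire function extending this expression. -/

import Mathlib

open MeasureTheory Filter Topology

/-- The integrand of the lower incomplete Gamma function is integrable near zero. -/
theorem intervalIntegrable_exp_neg_mul_rpow {s : ℝ} (hs : 0 < s) (x : ℝ) :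
    IntervalIntegrable (fun t : ℝ => Real.exp (-t) * t ^ (s - 1)) volume 0 x :=
  (intervalIntegral.intervalIntegrable_rpow' (by linarith)).continuousOn_mul
    (by fun_prop)

/-- The recurrence `s γ(s, x) = e^{-x} x^s + γ(s + 1, x)` of the lower incomplete Gamma function. -/
theorem mul_integral_exp_neg_mul_rpow {s x : ℝ} (hs : 0 < s) (hx : 0 ≤ x) :
    s * ∫ t in (0:ℝ)..x, Real.exp (-t) * t ^ (s - 1) =
      Real.exp (-x) * x ^ s + ∫ t in (0:ℝ)..x, Real.exp (-t) * t ^ (s + 1 - 1) := by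
  have h1 := intervalIntegrable_exp_neg_mul_rpow hs x
  have h2 := intervalIntegrable_exp_neg_mul_rpow (s := s + 1) (by linarith) x
  have key := intervalIntegral.integral_eq_sub_of_hasDerivAt_of_le
    (f := fun t : ℝ => Real.exp (-t) * t ^ s)
    (f' := fun t => s * (Real.exp (-t) * t ^ (s - 1)) - Real.exp (-t) * t ^ (s + 1 - 1)) hx
    ((Real.continuous_exp.comp continuous_neg).mul
      (Real.continuous_rpow_const hs.le)).continuousOn
    (fun t ht => by
      have := ((hasDerivAt_neg t).exp).mul (Real.hasDerivAt_rpow_const (p := s) (Or.inl ht.1.ne'))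
      refine this.congr_deriv ?_
      rw [add_sub_cancel_right]
      ring)
    ((h1.const_mul s).sub h2)
  rw [intervalIntegral.integral_sub (h1.const_mul s) h2, intervalIntegral.integral_const_mul,
    Real.zero_rpow hs.ne'] at key
  linarith

theorem integral_exp_neg_mul_rpow_nonneg (s : ℝ) {x : ℝ} (hx : 0 ≤ x) :
    0 ≤ ∫ t in (0:ℝ)..x, Real.exp (-t) * t ^ (s - 1) :=
  intervalIntegral.integral_nonneg hx fun _ ht =>
    mul_nonneg (Real.exp_pos _).le (Real.rpow_nonneg ht.1 _)

theorem integral_exp_neg_mul_rpow_le {s x : ℝ} (hs : 0 < s) (hx : 0 ≤ x) :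
    ∫ t in (0:ℝ)..x, Real.exp (-t) * t ^ (s - 1) ≤ x ^ s / s := by
  calc ∫ t in (0:ℝ)..x, Real.exp (-t) * t ^ (s - 1)
      ≤ ∫ t in (0:ℝ)..x, t ^ (s - 1) :=
        intervalIntegral.integral_mono_on hx (intervalIntegrable_exp_neg_mul_rpow hs x)
          (intervalIntegral.intervalIntegrable_rpow' (by linarith)) fun _ ht =>
            mul_le_of_le_one_left (Real.rpow_nonneg ht.1 _)
              (Real.exp_le_one_iff.2 (neg_nonpos.2 ht.1))
    _ = x ^ s / s := by
        rw [integral_rpow (Or.inl (by linarith)), sub_add_cancel, Real.zero_rpow hs.ne', sub_zero]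

/-- Iterating the recurrence of the lower incomplete Gamma function `N` times. -/
theorem exp_mul_rpow_neg_mul_integral_eq_sum_add {γ x : ℝ} (hγ : 0 < γ) (hx : 0 < x) (N : ℕ) :
    Real.exp x * x ^ (-γ) * (γ * ∫ t in (0:ℝ)..x, Real.exp (-t) * t ^ (γ - 1)) =
      ∑ n ∈ Finset.range N, x ^ n * (Real.Gamma (γ + 1) / Real.Gamma ((n : ℝ) + γ + 1)) +
        Real.exp x * x ^ (-γ) * (Real.Gamma (γ + 1) / Real.Gamma ((N : ℝ) + γ) *
          ∫ t in (0:ℝ)..x, Real.exp (-t) * t ^ ((N : ℝ) + γ - 1)) := by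
  induction N with
  | zero =>
    have := (Real.Gamma_pos_of_pos hγ).ne'
    simp only [Finset.range_zero, Finset.sum_empty, Nat.cast_zero, zero_add]
    rw [Real.Gamma_add_one hγ.ne', mul_div_cancel_right₀ _ this]
  | succ N ih =>
    have hs : 0 < (N : ℝ) + γ := by positivity
    have hG := (Real.Gamma_pos_of_pos hs).ne'
    have hrec := mul_integral_exp_neg_mul_rpow hs hx.le
    have hpow : x ^ (-γ) * x ^ ((N : ℝ) + γ) = x ^ N := by
      rw [← Real.rpow_add hx, ← Real.rpow_natCast]
      congr 1
      ring
    have hexp : Real.exp x * Real.exp (-x) = 1 := by rw [← Real.exp_add]; simp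
    rw [ih, Finset.sum_range_succ, add_assoc]
    congr 1
    have hcast : ((N + 1 : ℕ) : ℝ) + γ = (N : ℝ) + γ + 1 := by push_cast; ring
    rw [hcast, Real.Gamma_add_one hs.ne', eq_sub_of_add_eq' hrec.symm, ← hpow]
    field_simp
    linear_combination (x ^ ((N : ℝ) + γ)) * hexp

/-- The series expansion of the lower incomplete Gamma function. -/
theorem hasSum_pow_mul_Gamma_div_Gamma {γ x : ℝ} (hγ : 0 < γ) (hx : 0 < x) :
    HasSum (fun n : ℕ => x ^ n * (Real.Gamma (γ + 1) / Real.Gamma ((n : ℝ) + γ + 1)))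
      (Real.exp x * x ^ (-γ) * (γ * ∫ t in (0:ℝ)..x, Real.exp (-t) * t ^ (γ - 1))) := by
  have hG : ∀ s : ℝ, 0 < s → 0 < Real.Gamma s := fun s hs => Real.Gamma_pos_of_pos hs
  have hG1 := hG (γ + 1) (by positivity)
  have hrem_nonneg : ∀ N : ℕ, 0 ≤ Real.exp x * x ^ (-γ) *
      (Real.Gamma (γ + 1) / Real.Gamma ((N : ℝ) + γ) *
        ∫ t in (0:ℝ)..x, Real.exp (-t) * t ^ ((N : ℝ) + γ - 1)) := fun N => by
    have h1 := hG ((N : ℝ) + γ) (by positivity)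
    have h2 := integral_exp_neg_mul_rpow_nonneg ((N : ℝ) + γ) hx.le
    positivity
  have hterm_nonneg : ∀ n : ℕ,
      0 ≤ x ^ n * (Real.Gamma (γ + 1) / Real.Gamma ((n : ℝ) + γ + 1)) := fun n => by
    have h1 := hG ((n : ℝ) + γ + 1) (by positivity)
    positivity
  have hsum := summable_of_sum_range_le hterm_nonneg fun N =>
    (le_add_of_nonneg_right (hrem_nonneg N)).trans_eq
      (exp_mul_rpow_neg_mul_integral_eq_sum_add hγ hx N).symm
  have hrem_le : ∀ N : ℕ, Real.exp x * x ^ (-γ) *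
      (Real.Gamma (γ + 1) / Real.Gamma ((N : ℝ) + γ) *
        ∫ t in (0:ℝ)..x, Real.exp (-t) * t ^ ((N : ℝ) + γ - 1)) ≤
      Real.exp x * (x ^ N * (Real.Gamma (γ + 1) / Real.Gamma ((N : ℝ) + γ + 1))) := fun N => by
    have hs : 0 < (N : ℝ) + γ := by positivity
    have h1 := hG _ hs
    calc _ ≤ Real.exp x * x ^ (-γ) * (Real.Gamma (γ + 1) / Real.Gamma ((N : ℝ) + γ) *
          (x ^ ((N : ℝ) + γ) / ((N : ℝ) + γ))) := by
          gcongr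
          exact integral_exp_neg_mul_rpow_le hs hx.le
      _ = _ := by
          have hpow : x ^ N = x ^ (-γ) * x ^ ((N : ℝ) + γ) := by
            rw [← Real.rpow_add hx, ← Real.rpow_natCast]
            congr 1
            ring
          rw [Real.Gamma_add_one hs.ne', hpow]
          field_simp
  have hrem := squeeze_zero hrem_nonneg hrem_le
    (by simpa using hsum.tendsto_atTop_zero.const_mul (Real.exp x))
  rw [hsum.hasSum_iff_tendsto_nat]
  refine (by simpa using hrem.const_sub (Real.exp x * x ^ (-γ) *
    (γ * ∫ t in (0:ℝ)..x, Real.exp (-t) * t ^ (γ - 1))) : Tendsto _ _ _).congr fun N => ?_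
  exact sub_eq_of_eq_add (exp_mul_rpow_neg_mul_integral_eq_sum_add hγ hx N)

/-- For `γ > 0`, the entire function `φ_γ(x) = Σ_{n} x^n/n! · binom(n+γ,n)⁻¹`
(where `binom(n+γ,n)⁻¹ = Γ(γ+1)·n!/Γ(n+γ+1)`) satisfies, for `x > 0`,
`φ_γ(x) = e^x x^{-γ} · γ ∫_0^x e^{-t} t^{γ-1} dt`. -/
theorem stmt0 (γ : ℝ) (hγ : 0 < γ) (x : ℝ) (hx : 0 < x) :
    ∑' n : ℕ, x ^ n / (n.factorial : ℝ) *
      (Real.Gamma (γ + 1) * (n.factorial : ℝ) / Real.Gamma ((n : ℝ) + γ + 1)) =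
    Real.exp x * x ^ (-γ) *
      (γ * ∫ t in (0:ℝ)..x, Real.exp (-t) * t ^ (γ - 1)) := by
  rw [← (hasSum_pow_mul_Gamma_div_Gamma hγ hx).tsum_eq]
  refine tsum_congr fun n => ?_
  have := n.factorial_ne_zero
  field_simp
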